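/- Let m ≥ 2 be an integer, K a field, and R = K[x1,…,x_{3m+3}]. Let I_m be the ideal of R generated by the monomials x1x2 together with, for n = 1,…,m, x_{3n−2}x_{3n+2}, x_{3n+1}x_{3n+3}, x_{3n+1}x_{3n+2}, x_{3n−1}x_{3n+3}. Then the arithmetical rank of I_m equals 2m+1. -/

import Mathlib

/-- The variable `x k` (1-based indexing) of `K[x₁,…,x_{3m+3}]`; by convention it is `0`
for an out-of-range index `k` (all indices used below are in range). -/
noncomputable def xv (m : ℕ) (K : Type*) [Field K] (k : ℕ) :
    MvPolynomial (Fin (3 * m + 3)) K :=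
  if h : 1 ≤ k ∧ k ≤ 3 * m + 3 then MvPolynomial.X ⟨k - 1, by omega⟩ else 0

/-- The generating set of the ideal `I_m`: the monomials `x₁x₂` together with, for
`n = 1, …, m`, `x_{3n-2}x_{3n+2}`, `x_{3n+1}x_{3n+3}`, `x_{3n+1}x_{3n+2}` and
`x_{3n-1}x_{3n+3}`. -/
noncomputable def ImGens (m : ℕ) (K : Type*) [Field K] :
    Set (MvPolynomial (Fin (3 * m + 3)) K) :=
  {xv m K 1 * xv m K 2} ∪
    ⋃ n ∈ Set.Icc 1 m,
      ({xv m K (3 * n - 2) * xv m K (3 * n + 2),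
        xv m K (3 * n + 1) * xv m K (3 * n + 3),
        xv m K (3 * n + 1) * xv m K (3 * n + 2),
        xv m K (3 * n - 1) * xv m K (3 * n + 3)} :
        Set (MvPolynomial (Fin (3 * m + 3)) K))

open MvPolynomial in
/-- The hom killing the variables in `s`. -/
noncomputable def killHom {σ K : Type*} [DecidableEq σ] [Field K] (s : Finset σ) :
    MvPolynomial σ K →ₐ[K] MvPolynomial σ K :=
  aeval (fun i => if i ∈ s then 0 else X i)

/-- The prime generated by the variables in `s`. -/
noncomputable def killIdeal {σ : Type*} (K : Type*) [DecidableEq σ] [Field K] (s : Finset σ) :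
    Ideal (MvPolynomial σ K) := RingHom.ker (killHom (K := K) s)

instance killIdeal_prime {σ K : Type*} [DecidableEq σ] [Field K] (s : Finset σ) :
    (killIdeal K s).IsPrime := RingHom.ker_isPrime _

lemma X_mem_killIdeal {σ K : Type*} [DecidableEq σ] [Field K] (s : Finset σ) (i : σ) :
    (MvPolynomial.X i : MvPolynomial σ K) ∈ killIdeal K s ↔ i ∈ s := by
  simp [killIdeal, killHom, RingHom.mem_ker, MvPolynomial.X_ne_zero]

lemma sub_killHom_mem {σ K : Type*} [DecidableEq σ] [Field K] (s : Finset σ)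
    (J : Ideal (MvPolynomial σ K)) (hJ : ∀ i ∈ s, MvPolynomial.X i ∈ J) (p : MvPolynomial σ K) :
    p - killHom s p ∈ J := by
  induction p using MvPolynomial.induction_on with
  | C a => simp [killHom, MvPolynomial.algebraMap_eq]
  | add p q hp hq =>
    have := J.add_mem hp hq
    rw [map_add]
    convert this using 1
    ring
  | mul_X p i hp =>
    by_cases hi : i ∈ s
    · simp only [map_mul, killHom, MvPolynomial.aeval_X, hi, if_true, mul_zero, sub_zero]
      exact J.mul_mem_left _ (hJ i hi)
    · have := J.mul_mem_right (MvPolynomial.X i) hp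
      simp only [map_mul, killHom, MvPolynomial.aeval_X, hi, if_false] at this ⊢
      rwa [← sub_mul]

lemma killIdeal_le {σ K : Type*} [DecidableEq σ] [Field K] (s : Finset σ)
    (J : Ideal (MvPolynomial σ K)) (hJ : ∀ i ∈ s, MvPolynomial.X i ∈ J) :
    killIdeal K s ≤ J := by
  intro p hp
  have h := sub_killHom_mem s J hJ p
  have h2 : killHom s p = 0 := hp
  rwa [h2, sub_zero] at h

lemma card_le_height_killIdeal {σ K : Type*} [DecidableEq σ] [Field K] (s : Finset σ) :
    (s.card : ℕ∞) ≤ (killIdeal K s).height := by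
  induction s using Finset.induction_on with
  | empty => simp
  | insert a s ha ih =>
    have hlt : killIdeal K s < killIdeal K (insert a s) := by
      refine lt_of_le_of_ne (killIdeal_le _ _ fun i hi => ?_) fun h => ?_
      · rw [X_mem_killIdeal]; exact Finset.mem_insert_of_mem hi
      · apply ha
        rw [← X_mem_killIdeal (K := K), h, X_mem_killIdeal]
        exact Finset.mem_insert_self _ _
    rw [Finset.card_insert_of_notMem ha, Nat.cast_add, Nat.cast_one]
    exact (add_le_add_left ih 1).trans (Ideal.height_add_one_le_of_lt_of_isPrime hlt)

lemma xv_eq (m : ℕ) (K : Type*) [Field K] (k : ℕ) (h1 : 1 ≤ k) (h2 : k ≤ 3 * m + 3) :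
    xv m K k = MvPolynomial.X ⟨k - 1, by omega⟩ := by
  simp [xv, h1, h2]

lemma gens_mem (m : ℕ) (K : Type*) [Field K] (J : Ideal (MvPolynomial (Fin (3 * m + 3)) K)) :
    ImGens m K ⊆ J ↔ xv m K 1 * xv m K 2 ∈ J ∧ ∀ n, 1 ≤ n → n ≤ m →
      xv m K (3 * n - 2) * xv m K (3 * n + 2) ∈ J ∧
      xv m K (3 * n + 1) * xv m K (3 * n + 3) ∈ J ∧
      xv m K (3 * n + 1) * xv m K (3 * n + 2) ∈ J ∧
      xv m K (3 * n - 1) * xv m K (3 * n + 3) ∈ J := by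
  simp [ImGens, Set.insert_subset_iff, and_assoc]

lemma radical_eq_of_primes {R : Type*} [CommRing R] (A B : Set R)
    (h : ∀ P : Ideal R, P.IsPrime → (A ⊆ P ↔ B ⊆ P)) :
    (Ideal.span A).radical = (Ideal.span B).radical := by
  rw [Ideal.radical_eq_sInf, Ideal.radical_eq_sInf]
  congr 1
  ext P
  simp only [Set.mem_ofPred_eq, Ideal.span_le]
  constructor
  · rintro ⟨h1, h2⟩; exact ⟨(h P h2).1 h1, h2⟩
  · rintro ⟨h1, h2⟩; exact ⟨(h P h2).2 h1, h2⟩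

/-- The `2m+1` polynomials. -/
noncomputable def araF (m : ℕ) (K : Type*) [Field K] (i : ℕ) :
    MvPolynomial (Fin (3 * m + 3)) K :=
  if i = 0 then xv m K 1 * xv m K 2 else
  if i % 2 = 1 then
    xv m K (3 * ((i + 1) / 2) + 1) * xv m K (3 * ((i + 1) / 2) + 2) +
      xv m K (3 * ((i + 1) / 2) - 1) * xv m K (3 * ((i + 1) / 2) + 3)
  else
    xv m K (3 * ((i + 1) / 2) + 1) * xv m K (3 * ((i + 1) / 2) + 3) +
      xv m K (3 * ((i + 1) / 2) - 2) * xv m K (3 * ((i + 1) / 2) + 2)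

lemma step {R : Type*} [CommRing R] (P : Ideal R) (hP : P.IsPrime) (a b u v w : R)
    (h0 : a * b ∈ P) (h1 : u * v + b * w ∈ P) (h2 : u * w + a * v ∈ P) :
    a * v ∈ P ∧ u * w ∈ P ∧ u * v ∈ P ∧ b * w ∈ P := by
  have e1 : u * (u * v) ∈ P := by
    have : u * (u * v) = u * (u * v + b * w) - b * (u * w + a * v) + v * (a * b) := by
      ring
    rw [this]
    exact P.add_mem (P.sub_mem (P.mul_mem_left _ h1) (P.mul_mem_left _ h2)) (P.mul_mem_left _ h0)
  have e2 : u * (u * w) ∈ P := by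
    have : u * (u * w) = u * (u * w + a * v) - a * (u * v + b * w) + w * (a * b) := by
      ring
    rw [this]
    exact P.add_mem (P.sub_mem (P.mul_mem_left _ h2) (P.mul_mem_left _ h1)) (P.mul_mem_left _ h0)
  have f1 : u * v ∈ P := (hP.mem_or_mem e1).elim (fun h => P.mul_mem_right _ h) id
  have f2 : u * w ∈ P := (hP.mem_or_mem e2).elim (fun h => P.mul_mem_right _ h) id
  exact ⟨(P.add_mem_iff_right f2).1 h2, f2, f1, (P.add_mem_iff_right f1).1 h1⟩

lemma ara_upper (m : ℕ) (K : Type*) [Field K] :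
    (Ideal.span (Set.range fun i : Fin (2 * m + 1) => araF m K i)).radical =
      (Ideal.span (ImGens m K)).radical := by
  apply radical_eq_of_primes
  intro P hP
  rw [gens_mem, Set.range_subset_iff]
  constructor
  · intro h
    have h0 : xv m K 1 * xv m K 2 ∈ P := by simpa [araF] using h ⟨0, by omega⟩
    have key : ∀ n, 1 ≤ n → n ≤ m →
        xv m K (3 * n - 2) * xv m K (3 * n - 1) ∈ P →
        xv m K (3 * n - 2) * xv m K (3 * n + 2) ∈ P ∧
        xv m K (3 * n + 1) * xv m K (3 * n + 3) ∈ P ∧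
        xv m K (3 * n + 1) * xv m K (3 * n + 2) ∈ P ∧
        xv m K (3 * n - 1) * xv m K (3 * n + 3) ∈ P := by
      intro n h1 h2 h3
      have g1 := h ⟨2 * n - 1, by omega⟩
      have g2 := h ⟨2 * n, by omega⟩
      have q1 : (2 * n - 1 + 1) / 2 = n := by omega
      have q2 : (2 * n + 1) / 2 = n := by omega
      have r1 : (2 * n - 1) % 2 = 1 := by omega
      have r2 : ¬ (2 * n) % 2 = 1 := by omega
      have s1 : ¬ (2 * n - 1 = 0) := by omega
      have s2 : ¬ (2 * n = 0) := by omega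
      simp only [araF, q1, r1, s1, if_true, if_false] at g1
      simp only [araF, q2, r2, s2, if_false] at g2
      exact step P hP _ _ _ _ _ h3 g1 g2
    have all : ∀ n, n ≤ m → xv m K (3 * n + 1) * xv m K (3 * n + 2) ∈ P := by
      intro n
      induction n with
      | zero => intro _; simpa using h0
      | succ n ih =>
        intro hn
        exact (key (n + 1) (by omega) hn (ih (by omega))).2.2.1
    refine ⟨h0, fun n h1 h2 => key n h1 h2 ?_⟩
    have := all (n - 1) (by omega)
    have e1 : 3 * (n - 1) + 1 = 3 * n - 2 := by omega
    have e2 : 3 * (n - 1) + 2 = 3 * n - 1 := by omega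
    rwa [e1, e2] at this
  · rintro ⟨h0, h⟩ ⟨i, hi⟩
    simp only [araF]
    split_ifs with c1 c2
    · exact h0
    · obtain ⟨_, _, h3, h4⟩ := h ((i + 1) / 2) (by omega) (by omega)
      exact P.add_mem h3 h4
    · obtain ⟨h1, h2, _, _⟩ := h ((i + 1) / 2) (by omega) (by omega)
      exact P.add_mem h2 h1

/-- The vertex cover of size `2m+1` (0-based indices). -/
def coverS (m : ℕ) : Finset (Fin (3 * m + 3)) :=
  Finset.univ.filter fun i => i.val % 3 ≠ 0 ∧ i.val ≠ 2

lemma coverS_card (m : ℕ) : 2 * m + 1 ≤ (coverS m).card := by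
  have := Finset.card_le_card_of_injOn (s := (Finset.univ : Finset (Fin (2 * m + 1))))
    (t := coverS m)
    (fun k => ⟨if k.val = 0 then 1 else 3 * ((k.val + 1) / 2) + 1 + (k.val + 1) % 2, by
      have := k.2
      split_ifs <;> omega⟩)
    (by
      intro k _
      have := k.2
      simp only [coverS, Finset.coe_filter, Finset.mem_univ, true_and, Set.mem_ofPred_eq]
      split_ifs <;> omega)
    (by
      intro k _ l _ h
      have := k.2
      have := l.2
      simp only [Fin.mk.injEq] at h
      ext
      split_ifs at h <;> omega)
  simpa using this

lemma cover_minimal (m : ℕ) (K : Type*) [Field K] :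
    killIdeal K (coverS m) ∈ (Ideal.span (ImGens m K)).minimalPrimes := by
  have hx : ∀ k, 1 ≤ k → k ≤ 3 * m + 3 →
      (xv m K k ∈ killIdeal K (coverS m) ↔ (k - 1) % 3 ≠ 0 ∧ k - 1 ≠ 2) := by
    intro k h1 h2
    rw [xv_eq m K k h1 h2, X_mem_killIdeal]
    simp [coverS]
  refine ⟨⟨inferInstance, ?_⟩, ?_⟩
  · rw [Ideal.span_le, gens_mem]
    refine ⟨Ideal.mul_mem_left _ _ ((hx _ (by omega) (by omega)).2 (by omega)), ?_⟩
    intro n h1 h2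
    refine ⟨?_, ?_, ?_, ?_⟩ <;>
      exact Ideal.mul_mem_left _ _ ((hx _ (by omega) (by omega)).2 (by omega))
  · rintro Q ⟨hQ, hle⟩ hQP
    rw [Ideal.span_le, gens_mem] at hle
    obtain ⟨h0, h⟩ := hle
    have ha : ∀ n, n ≤ m → xv m K (3 * n + 1) ∉ Q := by
      intro n hn hmem
      have := (hx _ (by omega) (by omega)).1 (hQP hmem)
      omega
    apply killIdeal_le
    intro i hi
    simp only [coverS, Finset.mem_filter, Finset.mem_univ, true_and] at hi
    have hi2 := i.2
    have hxi : (MvPolynomial.X i : MvPolynomial (Fin (3 * m + 3)) K) = xv m K (i.val + 1) := by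
      rw [xv_eq m K _ (by omega) (by omega)]; simp
    rw [hxi]
    by_cases c0 : i.val = 1
    · rw [c0]
      exact (hQ.mem_or_mem h0).resolve_left (by simpa using ha 0 (by omega))
    · obtain ⟨_, h2, h3, _⟩ := h (i.val / 3) (by omega) (by omega)
      have hn := ha (i.val / 3) (by omega)
      by_cases c1 : i.val % 3 = 1
      · have e : i.val + 1 = 3 * (i.val / 3) + 2 := by omega
        rw [e]
        exact (hQ.mem_or_mem h3).resolve_left hn
      · have e : i.val + 1 = 3 * (i.val / 3) + 3 := by omega
        rw [e]
        exact (hQ.mem_or_mem h2).resolve_left hn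

/-- **Example 4 (Barile).** For `m ≥ 2`, the arithmetical rank of `I_m` equals `2m + 1`:
there are `2m + 1` elements of `R` generating an ideal with the same radical as `I_m`,
and no fewer elements do so. -/
theorem ara_Im_eq (m : ℕ) (hm : 2 ≤ m) (K : Type*) [Field K] :
    (∃ f : Fin (2 * m + 1) → MvPolynomial (Fin (3 * m + 3)) K,
      (Ideal.span (Set.range f)).radical = (Ideal.span (ImGens m K)).radical) ∧
    ∀ (n : ℕ) (f : Fin n → MvPolynomial (Fin (3 * m + 3)) K),
      (Ideal.span (Set.range f)).radical = (Ideal.span (ImGens m K)).radical →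
        2 * m + 1 ≤ n := by
  refine ⟨⟨fun i => araF m K i, ara_upper m K⟩, fun n f hf => ?_⟩
  have hmin := cover_minimal m K
  rw [← Ideal.radical_minimalPrimes, ← hf, Ideal.radical_minimalPrimes] at hmin
  classical
  have e : Set.range f = ((Finset.univ.image f : Finset _) : Set _) := by simp
  rw [e] at hmin
  have h1 := Ideal.height_le_card_of_mem_minimalPrimes_span_finset hmin
  have h2 := (card_le_height_killIdeal (K := K) (coverS m)).trans h1
  have h3 : (coverS m).card ≤ (Finset.univ.image f).card := by exact_mod_cast h2
  have h4 : (Finset.univ.image f).card ≤ n := by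
    simpa using Finset.card_image_le (s := Finset.univ) (f := f)
  have := coverS_card m
  omega
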